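/- Let (H,σ) be a difference field of characteristic zero with K := const(H,σ), and let H(t) be a ΠΣ*-extension of (H,σ). Inside an ambient difference field, let H(t) = G₀ ⊆ G₁ ⊆ … ⊆ G_e be a tower where each G_i = G_{i−1}(x_i), each x_i is transcendental over G_{i−1}, const(G_i,σ) = K, and for every i either σ(x_i) − x_i ∈ H(x₁,…,x_{i−1}) or (x_i ≠ 0 and σ(x_i)/x_i ∈ H(x₁,…,x_{i−1})). Let f₁,…,f_n ∈ H(t) and write f_i = h_i + p_i with h_i a proper fraction in t over H and p_i ∈ H[t]. Assume that the only pair (c,ρ) with c = (c₁,…,c_n) ∈ Kⁿ and ρ a proper fraction in t over H satisfying σ(ρ) − ρ = c₁·h₁ + … + c_n·h_n is c = 0 and ρ = 0. Then for every c = (c₁,…,c_n) ∈ Kⁿ and every g ∈ G_e with σ(g) − g = c₁·f₁ + … + c_n·f_n, one has c = 0 and g ∈ K. -/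

import Mathlib

/-- `L(t)`: the subfield generated by the subfield `L` and the element `t`. -/
def adj {E : Type*} [Field E] (L : Subfield E) (t : E) : Subfield E :=
  Subfield.closure ((L : Set E) ∪ {t})

/-- The subfield generated by the subfield `H` and a set `S` of elements. -/
def adjS {E : Type*} [Field E] (H : Subfield E) (S : Set E) : Subfield E :=
  Subfield.closure ((H : Set E) ∪ S)

/-- The set of constants of the subfield `L` with respect to the automorphism `σ`. -/
def constSet {E : Type*} [Field E] (σ : E ≃+* E) (L : Subfield E) : Set E :=
  {c : E | c ∈ L ∧ σ c = c}

/-- A polynomial with all coefficients in the subfield `L`. -/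
def polyOver {E : Type*} [Field E] (L : Subfield E) (P : Polynomial E) : Prop :=
  ∀ n, P.coeff n ∈ L

/-- `g ∈ L[t]`: `g` is a polynomial expression in `t` with coefficients in `L`. -/
def isPolyIn {E : Type*} [Field E] (L : Subfield E) (t g : E) : Prop :=
  ∃ P : Polynomial E, polyOver L P ∧ g = Polynomial.eval t P

/-- `g` is a proper fraction in `t` over `L`: `g = U(t)/V(t)` with `deg U < deg V`. -/
def isProperFrac {E : Type*} [Field E] (L : Subfield E) (t g : E) : Prop :=
  ∃ U V : Polynomial E, polyOver L U ∧ polyOver L V ∧ U.degree < V.degree ∧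
    g = Polynomial.eval t U / Polynomial.eval t V

open Polynomial

section AffineTwist

variable {K : Type*} [Field K]

/-- The endomorphism of `K[X]` acting as `τ` on coefficients and sending `X` to `αX + β`. -/
noncomputable def affineTwist (τ : K →+* K) (α β : K) : K[X] →+* K[X] :=
  (compRingHom (C α * X + C β)).comp (mapRingHom τ)

theorem affineTwist_apply (τ : K →+* K) (α β : K) (P : K[X]) :
    affineTwist τ α β P = (P.map τ).comp (C α * X + C β) := rfl

theorem degree_affineTwist (τ : K →+* K) {α : K} (hα : α ≠ 0) (β : K) (P : K[X]) :
    (affineTwist τ α β P).degree = P.degree := by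
  have h : (C α * X + C β).degree = 1 := degree_linear hα
  rw [affineTwist_apply, degree_comp (by rw [h]; exact zero_lt_one), h, degree_map, mul_one]

theorem derivative_affineTwist_one (τ : K →+* K) (β : K) (P : K[X]) :
    derivative (affineTwist τ 1 β P) = affineTwist τ 1 β (derivative P) := by
  simp [affineTwist_apply, derivative_comp, derivative_map]

theorem eval_zero_affineTwist (τ : K →+* K) (α : K) (P : K[X]) :
    (affineTwist τ α 0 P).eval 0 = τ (P.eval 0) := by
  simp [affineTwist_apply, eval_comp]

end AffineTwist

section Fractions

variable {E : Type*} [Field E] {L : Subfield E} {t : E}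

theorem eval_map_subtype (P : L[X]) : eval t (P.map L.subtype) = aeval t P := by
  rw [eval_map, aeval_def]; rfl

theorem polyOver_map_subtype (P : L[X]) : polyOver L (P.map L.subtype) := fun n => by
  rw [coeff_map]; exact (P.coeff n).2

theorem polyOver.exists_map_eq {P : E[X]} (hP : polyOver L P) :
    ∃ Q : L[X], Q.map L.subtype = P :=
  (lifts_iff_set_range P).1 ((lifts_iff_coeff_lifts P).2 fun n => ⟨⟨_, hP n⟩, rfl⟩)

theorem isPolyIn_iff_aeval {g : E} : isPolyIn L t g ↔ ∃ P : L[X], g = aeval t P := by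
  constructor
  · rintro ⟨P, hP, rfl⟩
    obtain ⟨Q, rfl⟩ := hP.exists_map_eq
    exact ⟨Q, eval_map_subtype Q⟩
  · rintro ⟨P, rfl⟩
    exact ⟨_, polyOver_map_subtype P, (eval_map_subtype P).symm⟩

theorem isPolyIn_iff_mem_adjoin {g : E} : isPolyIn L t g ↔ g ∈ Algebra.adjoin L {t} := by
  rw [isPolyIn_iff_aeval, Algebra.adjoin_singleton_eq_range_aeval]
  simp only [AlgHom.mem_range, eq_comm]

theorem isProperFrac_iff_aeval {g : E} : isProperFrac L t g ↔
    ∃ U V : L[X], U.degree < V.degree ∧ g = aeval t U / aeval t V := by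
  constructor
  · rintro ⟨U, V, hU, hV, hd, rfl⟩
    obtain ⟨U, rfl⟩ := hU.exists_map_eq
    obtain ⟨V, rfl⟩ := hV.exists_map_eq
    rw [degree_map, degree_map] at hd
    exact ⟨U, V, hd, by rw [eval_map_subtype, eval_map_subtype]⟩
  · rintro ⟨U, V, hd, rfl⟩
    exact ⟨_, _, polyOver_map_subtype U, polyOver_map_subtype V, by rwa [degree_map, degree_map],
      by rw [eval_map_subtype, eval_map_subtype]⟩

theorem isProperFrac.mono {L' : Subfield E} (hL : L ≤ L') {g : E} :
    isProperFrac L t g → isProperFrac L' t g := by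
  rintro ⟨U, V, hU, hV, h⟩
  exact ⟨U, V, fun n => hL (hU n), fun n => hL (hV n), h⟩

theorem isPolyIn.mono {L' : Subfield E} (hL : L ≤ L') {g : E} :
    isPolyIn L t g → isPolyIn L' t g := by
  rintro ⟨P, hP, h⟩
  exact ⟨P, fun n => hL (hP n), h⟩

theorem aeval_ne_zero_of_transcendental (ht : Transcendental L t) {V : L[X]} (hV : V ≠ 0) :
    aeval t V ≠ 0 := fun h => hV (transcendental_iff.1 ht V h)

theorem isProperFrac_zero : isProperFrac L t 0 :=
  isProperFrac_iff_aeval.2 ⟨0, 1, by simp, by simp⟩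

theorem isProperFrac.add (ht : Transcendental L t) {a b : E} (ha : isProperFrac L t a)
    (hb : isProperFrac L t b) : isProperFrac L t (a + b) := by
  rw [isProperFrac_iff_aeval] at ha hb ⊢
  obtain ⟨U, V, hUV, rfl⟩ := ha
  obtain ⟨U', V', hUV', rfl⟩ := hb
  have hV : V ≠ 0 := ne_zero_of_degree_gt hUV
  have hV' : V' ≠ 0 := ne_zero_of_degree_gt hUV'
  refine ⟨U * V' + V * U', V * V', ?_, ?_⟩
  · refine (degree_add_le _ _).trans_lt (max_lt ?_ ?_)
    · rw [degree_mul, degree_mul]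
      exact WithBot.add_lt_add_right (degree_ne_bot.2 hV') hUV
    · rw [degree_mul, degree_mul]
      exact WithBot.add_lt_add_left (degree_ne_bot.2 hV) hUV'
  · rw [div_add_div _ _ (aeval_ne_zero_of_transcendental ht hV)
      (aeval_ne_zero_of_transcendental ht hV')]
    simp

theorem isProperFrac.const_mul {a c : E} (hc : c ∈ L) (ha : isProperFrac L t a) :
    isProperFrac L t (c * a) := by
  rw [isProperFrac_iff_aeval] at ha ⊢
  obtain ⟨U, V, hUV, rfl⟩ := ha
  refine ⟨C ⟨c, hc⟩ * U, V, ?_, ?_⟩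
  · rw [← smul_eq_C_mul]
    exact (degree_smul_le _ _).trans_lt hUV
  · rw [map_mul, aeval_C, mul_div_assoc]
    rfl

theorem isProperFrac.sub (ht : Transcendental L t) {a b : E} (ha : isProperFrac L t a)
    (hb : isProperFrac L t b) : isProperFrac L t (a - b) := by
  have := ha.add ht (hb.const_mul (neg_mem (one_mem L)))
  rwa [neg_one_mul, ← sub_eq_add_neg] at this

theorem isProperFrac_sum {ι : Type*} (s : Finset ι) (ht : Transcendental L t) {a : ι → E}
    (ha : ∀ i ∈ s, isProperFrac L t (a i)) : isProperFrac L t (∑ i ∈ s, a i) :=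
  Finset.sum_induction _ _ (fun _ _ => isProperFrac.add ht) isProperFrac_zero ha

theorem eq_zero_of_isProperFrac_of_isPolyIn (ht : Transcendental L t) {a : E}
    (ha : isProperFrac L t a) (hp : isPolyIn L t a) : a = 0 := by
  obtain ⟨U, V, hUV, rfl⟩ := isProperFrac_iff_aeval.1 ha
  obtain ⟨P, hP⟩ := isPolyIn_iff_aeval.1 hp
  have hV : V ≠ 0 := ne_zero_of_degree_gt hUV
  rw [div_eq_iff (aeval_ne_zero_of_transcendental ht hV), ← map_mul] at hP
  have hU : U = P * V := transcendental_iff_injective.1 ht hP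
  have hP0 : P = 0 := by
    by_contra hP0
    rw [hU, mul_comm] at hUV
    exact hUV.not_ge (degree_le_mul_left V hP0)
  simp [hU, hP0]

theorem adj_eq_toSubfield_adjoin :
    adj L t = (IntermediateField.adjoin L {t}).toSubfield := by
  rw [IntermediateField.adjoin_toSubfield, adj]
  congr 2
  exact Subtype.range_coe.symm

theorem le_adj : L ≤ adj L t := fun _ ha => Subfield.subset_closure (Or.inl ha)

theorem self_mem_adj : t ∈ adj L t := Subfield.subset_closure (Or.inr rfl)

theorem aeval_mem_adj (P : L[X]) : aeval t P ∈ adj L t := by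
  rw [adj_eq_toSubfield_adjoin]
  exact (IntermediateField.mem_adjoin_simple_iff L _).2 ⟨P, 1, by simp⟩

theorem isProperFrac.mem_adj {g : E} (hg : isProperFrac L t g) : g ∈ adj L t := by
  obtain ⟨U, V, -, rfl⟩ := isProperFrac_iff_aeval.1 hg
  exact div_mem (aeval_mem_adj U) (aeval_mem_adj V)

theorem exists_properFrac_add_aeval (ht : Transcendental L t) {g : E} (hg : g ∈ adj L t) :
    ∃ (r : E) (Q : L[X]), isProperFrac L t r ∧ g = r + aeval t Q := by
  rw [adj_eq_toSubfield_adjoin] at hg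
  obtain ⟨U, V, rfl⟩ := (IntermediateField.mem_adjoin_simple_iff L _).1 hg
  rcases eq_or_ne V 0 with rfl | hV
  · exact ⟨0, 0, isProperFrac_zero, by simp⟩
  · refine ⟨aeval t (U % V) / aeval t V, U / V,
      isProperFrac_iff_aeval.2 ⟨_, _, degree_mod_lt U hV, rfl⟩, ?_⟩
    rw [div_add' _ _ _ (aeval_ne_zero_of_transcendental ht hV), ← map_mul, ← map_add, mul_comm,
      EuclideanDomain.mod_add_div]

theorem adj_eq_sup : adj L t = L ⊔ Subfield.closure {t} := by
  rw [adj, Subfield.closure_union, Subfield.closure_eq]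

theorem adj_right_comm (x : E) : adj (adj L t) x = adj (adj L x) t := by
  simp only [adj_eq_sup]
  exact sup_right_comm _ _ _

/-- Exchange: if `t, x` are algebraically independent over `L` then so are `x, t`. -/
theorem transcendental_adj_swap {x : E} (ht : Transcendental L t)
    (hx : Transcendental (adj L t) x) : Transcendental (adj L x) t := by
  rw [adj_eq_toSubfield_adjoin] at hx ⊢
  replace hx : Transcendental (Algebra.adjoin L {t}) x :=
    IntermediateField.transcendental_adjoin_iff.1 hx
  suffices h : Transcendental (Algebra.adjoin L {x}) t from
    IntermediateField.transcendental_adjoin_iff.2 h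
  have hne : t ≠ x := by
    rintro rfl
    exact hx (isAlgebraic_algebraMap
      (⟨t, Algebra.subset_adjoin rfl⟩ : Algebra.adjoin L {t}))
  have h1 : AlgebraicIndepOn L id {t} := algebraicIndependent_unique_type_iff.2 ht
  have h2 : AlgebraicIndepOn L id {x, t} := h1.insert (by rwa [Set.image_id])
  rw [Set.pair_comm] at h2
  have h3 := ((AlgebraicIndepOn.insert_iff (by simpa using hne)).1 h2).2
  rwa [Set.image_id] at h3

end Fractions

section Difference

variable {E : Type*} [Field E] {σ : E ≃+* E} {L : Subfield E} {t : E}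

/-- The restriction of `σ` to a `σ`-stable subfield. -/
def restrictEndo (σ : E ≃+* E) (L : Subfield E) (hL : ∀ a ∈ L, σ a ∈ L) : L →+* L :=
  (σ : E →+* E).restrict L L hL

theorem aeval_affineTwist (hL : ∀ a ∈ L, σ a ∈ L) {α β : L} (hσt : σ t = α * t + β) (P : L[X]) :
    aeval t (affineTwist (restrictEndo σ L hL) α β P) = σ (aeval t P) := by
  rw [affineTwist_apply, aeval_comp]
  have : aeval t (C α * X + C β) = σ t := by
    rw [hσt]; simp [Algebra.algebraMap_eq_smul_one, Subfield.smul_def]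
  rw [this, aeval_def, aeval_def, eval₂_map, ← RingEquiv.coe_toRingHom, hom_eval₂]
  rfl

theorem isProperFrac.map (hL : ∀ a ∈ L, σ a ∈ L) {α β : L} (hα : α ≠ 0)
    (hσt : σ t = α * t + β) {g : E} (hg : isProperFrac L t g) : isProperFrac L t (σ g) := by
  rw [isProperFrac_iff_aeval] at hg ⊢
  obtain ⟨U, V, hUV, rfl⟩ := hg
  refine ⟨affineTwist (restrictEndo σ L hL) α β U, affineTwist (restrictEndo σ L hL) α β V, ?_, ?_⟩
  · rwa [degree_affineTwist _ hα, degree_affineTwist _ hα]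
  · rw [aeval_affineTwist hL hσt, aeval_affineTwist hL hσt, map_div₀]

/-- The proper-fraction part of a telescoping solution solves the proper-fraction part of the
telescoping equation. -/
theorem exists_properFrac_solution (ht : Transcendental L t) (hL : ∀ a ∈ L, σ a ∈ L) {α β : L}
    (hα : α ≠ 0) (hσt : σ t = α * t + β) {g h q : E} (hg : g ∈ adj L t)
    (hh : isProperFrac L t h) (hq : isPolyIn L t q) (heq : σ g - g = h + q) :
    ∃ (r : E) (Q : L[X]), isProperFrac L t r ∧ g = r + aeval t Q ∧ σ r - r = h := by
  obtain ⟨r, Q, hr, rfl⟩ := exists_properFrac_add_aeval ht hg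
  refine ⟨r, Q, hr, rfl, ?_⟩
  rw [map_add, ← aeval_affineTwist hL hσt] at heq
  have hprop : isProperFrac L t (σ r - r - h) := ((hr.map hL hα hσt).sub ht hr).sub ht hh
  have hpol : isPolyIn L t (σ r - r - h) := by
    rw [isPolyIn_iff_aeval] at hq ⊢
    obtain ⟨P, rfl⟩ := hq
    refine ⟨P - affineTwist (restrictEndo σ L hL) α β Q + Q, ?_⟩
    rw [map_add, map_sub]
    linear_combination heq
  exact sub_eq_zero.1 (eq_zero_of_isProperFrac_of_isPolyIn ht hprop hpol)

theorem exists_aeval_solution (ht : Transcendental L t) (hL : ∀ a ∈ L, σ a ∈ L) {α β : L}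
    (hα : α ≠ 0) (hσt : σ t = α * t + β) {g : E} {h : L} (hg : g ∈ adj L t)
    (heq : σ g - g = h) :
    ∃ Q : L[X], affineTwist (restrictEndo σ L hL) α β Q - Q = C h := by
  obtain ⟨r, Q, -, rfl, h0⟩ := exists_properFrac_solution ht hL hα hσt hg isProperFrac_zero
    (q := h) (isPolyIn_iff_aeval.2 ⟨C h, by rw [aeval_C]; rfl⟩) (by rw [heq, zero_add])
  refine ⟨Q, transcendental_iff_injective.1 ht ?_⟩
  rw [map_sub, aeval_affineTwist hL hσt, aeval_C]
  rw [map_add] at heq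
  change _ = (h : E)
  linear_combination heq - h0

/-- A telescoping solution in a `Π`-extension descends to the ground field. -/
theorem exists_solution_of_prod (ht : Transcendental L t) (hL : ∀ a ∈ L, σ a ∈ L) {α : L}
    (hα : α ≠ 0) (hσt : σ t = α * t) {g h : E} (hh : h ∈ L) (hg : g ∈ adj L t)
    (heq : σ g - g = h) : ∃ w ∈ L, σ w - w = h := by
  obtain ⟨Q, hQ⟩ := exists_aeval_solution (β := 0) (h := ⟨h, hh⟩) ht hL hα
    (by simpa using hσt) hg heq
  refine ⟨(Q.eval (0 : L) : L), (Q.eval (0 : L)).2, ?_⟩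
  have := congrArg (fun P => ((P.eval 0 : L) : E)) hQ
  simp only [eval_sub, eval_zero_affineTwist, eval_C] at this
  exact this

/-- A telescoping solution in a `Σ`-extension descends to the ground field, up to a constant
multiple of the generator. -/
theorem exists_solution_of_sum [CharZero E] (ht : Transcendental L t) (hL : ∀ a ∈ L, σ a ∈ L)
    {β : L} (hσt : σ t = t + β) (hconst : constSet σ (adj L t) ⊆ L) {g h : E} (hh : h ∈ L)
    (hg : g ∈ adj L t) (heq : σ g - g = h) :
    ∃ w ∈ L, ∃ k ∈ constSet σ L, σ w - w + k * (σ t - t) = h := by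
  have hσt' : σ t = (1 : L) * t + β := by simpa using hσt
  obtain ⟨Q, hQ⟩ := exists_aeval_solution (h := ⟨h, hh⟩) ht hL one_ne_zero hσt' hg heq
  have hD : affineTwist (restrictEndo σ L hL) 1 β (derivative Q) = derivative Q := by
    have := congrArg derivative hQ
    rwa [derivative_sub, derivative_affineTwist_one, derivative_C, sub_eq_zero] at this
  have hfix : σ (aeval t (derivative Q)) = aeval t (derivative Q) := by
    rw [← aeval_affineTwist hL hσt', hD]
  obtain ⟨k, hk⟩ : ∃ k : L, derivative Q = C k := by
    refine ⟨⟨_, hconst ⟨aeval_mem_adj _, hfix⟩⟩, transcendental_iff_injective.1 ht ?_⟩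
    rw [aeval_C]
    rfl
  have hQlin : Q = C (Q.coeff 0) + C k * X := by
    have h0 : derivative (Q - C k * X) = 0 := by simp [hk]
    have h1 := eq_C_of_derivative_eq_zero h0
    have h2 : (Q - C k * X).coeff 0 = Q.coeff 0 := by simp
    rw [h2] at h1
    exact sub_eq_iff_eq_add.1 h1
  have hkσ : σ k = k := by
    rw [hk, aeval_C] at hfix
    exact hfix
  refine ⟨Q.coeff 0, (Q.coeff 0).2, k, ⟨k.2, hkσ⟩, ?_⟩
  have hev := congrArg (aeval t) hQ
  rw [map_sub, aeval_affineTwist hL hσt', hQlin] at hev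
  simp only [map_add, map_mul, aeval_C, aeval_X] at hev
  change σ (Q.coeff 0 : E) + σ (k : E) * σ t - ((Q.coeff 0 : E) + k * t) = h at hev
  rw [hkσ] at hev
  linear_combination hev

theorem map_mem_subfieldClosure {S : Set E} (hS : ∀ a ∈ S, σ a ∈ Subfield.closure S) :
    ∀ a ∈ Subfield.closure S, σ a ∈ Subfield.closure S := by
  have : Subfield.closure S ≤ (Subfield.closure S).comap (σ : E →+* E) :=
    Subfield.closure_le.2 hS
  exact fun a ha => this ha

theorem map_mem_adj (hL : ∀ a ∈ L, σ a ∈ L) (ht : σ t ∈ adj L t) :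
    ∀ a ∈ adj L t, σ a ∈ adj L t := by
  refine map_mem_subfieldClosure ?_
  rintro a (ha | rfl)
  · exact le_adj (hL a ha)
  · exact ht

/-- Descent of proper-fraction solutions along one `ΠΣ`-generator independent of `t`. -/
theorem exists_properFrac_solution_descent [CharZero E] {x : E} (ht : Transcendental L t)
    (hL : ∀ a ∈ L, σ a ∈ L) {α β : L} (hα : α ≠ 0) (hσt : σ t = α * t + β)
    (hx : Transcendental (adj L t) x)
    (hconst : constSet σ (adj (adj L t) x) ⊆ L)
    (hσx : σ x - x ∈ L ∨ x ≠ 0 ∧ σ x / x ∈ L)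
    {g h : E} (hh : isProperFrac L t h) (hg : isProperFrac (adj L x) t g)
    (heq : σ g - g = h) : ∃ r, isProperFrac L t r ∧ σ r - r = h := by
  have hF : ∀ a ∈ adj L t, σ a ∈ adj L t := map_mem_adj hL <| by
    rw [hσt]
    exact add_mem (mul_mem (le_adj α.2) self_mem_adj) (le_adj β.2)
  have hg' : g ∈ adj (adj L t) x := adj_right_comm (L := L) (t := t) x ▸ hg.mem_adj
  obtain ⟨w, hw, q, hq, hwq⟩ : ∃ w ∈ adj L t, ∃ q ∈ L, σ w - w = h + q := by
    rcases hσx with hσx | ⟨hx0, hσx⟩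
    · obtain ⟨w, hw, k, hk, hwk⟩ := exists_solution_of_sum (β := ⟨_, le_adj hσx⟩) hx hF
        (by simp) (hconst.trans le_adj) hh.mem_adj hg' heq
      have hkL : k ∈ L := hconst ⟨le_adj hk.1, hk.2⟩
      exact ⟨w, hw, -(k * (σ x - x)), neg_mem (mul_mem hkL hσx), by linear_combination hwk⟩
    · have hα' : (⟨σ x / x, le_adj hσx⟩ : adj L t) ≠ 0 := by
        rw [Ne, Subtype.ext_iff]
        exact div_ne_zero ((map_ne_zero σ).2 hx0) hx0
      obtain ⟨w, hw, hwh⟩ := exists_solution_of_prod hx hF hα'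
        (div_mul_cancel₀ _ hx0).symm hh.mem_adj hg' heq
      exact ⟨w, hw, 0, zero_mem L, by rw [hwh, add_zero]⟩
  obtain ⟨r, -, hr, -, hrh⟩ := exists_properFrac_solution ht hL hα hσt hw hh
    (isPolyIn_iff_aeval.2 ⟨C ⟨q, hq⟩, by rw [aeval_C]; rfl⟩) hwq
  exact ⟨r, hr, hrh⟩

theorem adjS_succ (H : Subfield E) (x : ℕ → E) (i : ℕ) :
    adjS H (x '' {j | j < i + 1}) = adj (adjS H (x '' {j | j < i})) (x i) := by
  have : {j | j < i + 1} = insert i {j | j < i} := by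
    ext j; simp only [Set.mem_ofPred_eq, Set.mem_insert_iff]; omega
  rw [this, Set.image_insert_eq, adj_eq_sup, adjS, adjS, Set.insert_eq, Set.union_comm {x i},
    ← Set.union_assoc, Subfield.closure_union]

theorem adjS_zero (H : Subfield E) (x : ℕ → E) : adjS H (x '' {j | j < 0}) = H := by
  simp [adjS]

theorem le_adjS (H : Subfield E) (S : Set E) : H ≤ adjS H S :=
  fun _ ha => Subfield.subset_closure (Or.inl ha)

end Difference

/-- If the rational (proper-fraction) part of parameterized telescoping has only
the trivial solution, then in any ΠΣ*-extension of `H(t)` over `H` every solution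
`σ(g) - g = Σ cᵢ·fᵢ` has `c = 0` and `g` a constant. -/
theorem trivial_rational_part {E : Type*} [Field E] [CharZero E] (σ : E ≃+* E)
    (H : Subfield E) (hH : H.map (σ : E →+* E) = H)
    -- H(t) is a ΠΣ*-extension of H
    (t : E) (htrans : Transcendental H t)
    (hconst : constSet σ (adj H t) = constSet σ H)
    (hPS : (σ t - t ∈ H ∧ σ t - t ≠ 0) ∨ σ t / t ∈ H)
    -- the tower H(t) = G₀ ⊆ G₁ ⊆ … ⊆ G_e with generators x₁,…,x_e free of t
    (e : ℕ) (G : ℕ → Subfield E) (x : ℕ → E)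
    (hG0 : G 0 = adj H t)
    (hGadj : ∀ i < e, G (i + 1) = adj (G i) (x i))
    (hxtr : ∀ i < e, Transcendental (G i) (x i))
    (hGconst : ∀ i ≤ e, constSet σ (G i) = constSet σ H)
    (hxPS : ∀ i < e, σ (x i) - x i ∈ adjS H (x '' {j | j < i}) ∨
        (x i ≠ 0 ∧ σ (x i) / x i ∈ adjS H (x '' {j | j < i})))
    -- splitting fᵢ = hᵢ + pᵢ
    (n : ℕ) (f h p : Fin n → E)
    (hsplit : ∀ i, f i = h i + p i)
    (hfrac : ∀ i, isProperFrac H t (h i))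
    (hpol : ∀ i, isPolyIn H t (p i))
    -- the rational part has only the trivial solution
    (htriv : ∀ (c : Fin n → E) (ρ : E), (∀ i, c i ∈ constSet σ H) →
      isProperFrac H t ρ → σ ρ - ρ = ∑ i, c i * h i → (∀ i, c i = 0) ∧ ρ = 0) :
    ∀ (c : Fin n → E), (∀ i, c i ∈ constSet σ H) →
      ∀ g ∈ G e, σ g - g = ∑ i, c i * f i →
        (∀ i, c i = 0) ∧ g ∈ constSet σ H := by
  intro c hc g hg heq
  have hHσ : ∀ a ∈ H, σ a ∈ H := fun a ha => by
    have : σ a ∈ H.map (σ : E →+* E) := ⟨a, ha, rfl⟩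
    rwa [hH] at this
  have ht0 : t ≠ 0 := by
    rintro rfl
    exact htrans isAlgebraic_zero
  obtain ⟨α, β, hα, hσt⟩ : ∃ α β : H, α ≠ 0 ∧ σ t = α * t + β := by
    rcases hPS with ⟨hb, -⟩ | ha
    · exact ⟨1, ⟨_, hb⟩, one_ne_zero, by simp⟩
    · refine ⟨⟨_, ha⟩, 0, ?_, by simp [ht0]⟩
      rw [Ne, Subtype.ext_iff]
      exact div_ne_zero ((map_ne_zero σ).2 ht0) ht0
  set M : ℕ → Subfield E := fun i => adjS H (x '' {j | j < i}) with hM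
  have hM0 : M 0 = H := adjS_zero H x
  have hMsucc : ∀ i, M (i + 1) = adj (M i) (x i) := adjS_succ H x
  have hHM : ∀ i, H ≤ M i := fun i => le_adjS H _
  have htower : ∀ i ≤ e, G i = adj (M i) t ∧ Transcendental (M i) t ∧ ∀ a ∈ M i, σ a ∈ M i := by
    intro i
    induction i with
    | zero =>
      intro _
      rw [hM0]
      exact ⟨hG0, htrans, hHσ⟩
    | succ i ih =>
      intro hi
      obtain ⟨hG, htr, hst⟩ := ih (by omega)
      have hx := hxtr i hi
      rw [hG] at hx
      rw [hMsucc]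
      refine ⟨by rw [hGadj i hi, hG, adj_right_comm], transcendental_adj_swap htr hx,
        map_mem_adj hst ?_⟩
      rcases hxPS i hi with hs | ⟨hx0, hs⟩
      · rw [← sub_add_cancel (σ (x i)) (x i)]
        exact add_mem (le_adj hs) self_mem_adj
      · rw [← div_mul_cancel₀ (σ (x i)) hx0]
        exact mul_mem (le_adj hs) self_mem_adj
  have hlift : ∀ i, ∃ α' β' : M i, α' ≠ 0 ∧ σ t = α' * t + β' := fun i =>
    ⟨⟨α, hHM i α.2⟩, ⟨β, hHM i β.2⟩, Subtype.coe_ne_coe.1 (Subtype.coe_ne_coe.2 hα :), hσt⟩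
  have hhp : isProperFrac H t (∑ i, c i * h i) :=
    isProperFrac_sum _ htrans fun i _ => (hfrac i).const_mul (hc i).1
  have hpp : isPolyIn H t (∑ i, c i * p i) := by
    rw [isPolyIn_iff_mem_adjoin]
    exact sum_mem fun i _ => mul_mem (Subalgebra.algebraMap_mem _ (⟨c i, (hc i).1⟩ : H))
      (isPolyIn_iff_mem_adjoin.1 (hpol i))
  have hsol : ∀ i ≤ e, ∃ r, isProperFrac (M i) t r ∧ σ r - r = ∑ i, c i * h i := by
    intro i hi
    induction hi using Nat.decreasingInduction with
    | self =>
      obtain ⟨hG, htr, hst⟩ := htower e le_rfl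
      obtain ⟨α', β', hα', hσt'⟩ := hlift e
      rw [hG] at hg
      obtain ⟨r, -, hr, -, hrh⟩ := exists_properFrac_solution htr hst hα' hσt' hg
        (hhp.mono (hHM e)) (hpp.mono (hHM e))
        (by simp only [heq, hsplit, mul_add, Finset.sum_add_distrib])
      exact ⟨r, hr, hrh⟩
    | of_succ i hi ih =>
      obtain ⟨r, hr, hrh⟩ := ih
      obtain ⟨hG, htr, hst⟩ := htower i hi.le
      obtain ⟨α', β', hα', hσt'⟩ := hlift i
      have hx := hxtr i hi
      have hK : constSet σ (G (i + 1)) ⊆ M i := by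
        rw [hGconst (i + 1) hi]
        exact fun a ha => hHM i ha.1
      rw [hGadj i hi, hG] at hK
      rw [hG] at hx
      rw [hMsucc] at hr
      exact exists_properFrac_solution_descent htr hst hα' hσt' hx hK (hxPS i hi)
        (hhp.mono (hHM i)) hr hrh
  obtain ⟨r, hr, hrh⟩ := hsol 0 (Nat.zero_le e)
  rw [hM0] at hr
  have hc0 : ∀ i, c i = 0 := (htriv c r hc hr hrh).1
  refine ⟨hc0, ?_⟩
  rw [← hGconst e le_rfl]
  exact ⟨hg, by simpa [hc0, sub_eq_zero] using heq⟩
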